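/- Let F be an (m,s)-function and λ ∈ GF(2^s)\{0}. Then for every a ∈ GF(2^m) with a ≠ 0, the codewords of C_{D_{f_λ}} satisfy wt(c_{a,0}) = (2·n_{f_λ} + Ŵ_F(λ,a))/4 and wt(c_{a,λ}) = (2·n_{f_λ} − Ŵ_F(λ,a))/4; moreover wt(c_{0,λ}) = n_{f_λ}. -/

import Mathlib

open Finset
noncomputable section
open scoped Classical

/-- `GF n` is the finite field with `2^n` elements. -/
abbrev GF (n : ℕ) : Type := GaloisField 2 n

noncomputable instance (n : ℕ) : Fintype (GF n) := Fintype.ofFinite _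

/-- The absolute trace map `GF n → 𝔽₂`. -/
def tr {n : ℕ} (x : GF n) : ZMod 2 := Algebra.trace (ZMod 2) (GF n) x

/-- The Walsh transform of an `(m,s)`-function `F` at `(α, β)`. -/
def walshF {m s : ℕ} (F : GF m → GF s) (α : GF s) (β : GF m) : ℤ :=
  ∑ x : GF m, (-1 : ℤ) ^ (tr (α * F x) + tr (β * x)).val

/-- The support `D_{f_λ}` of the component function `f_λ = Tr(λ·F)`. -/
abbrev Dsupp {m s : ℕ} (F : GF m → GF s) (lam : GF s) : Type :=
  {d : GF m // tr (lam * F d) = 1}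

/-- `n_{f_λ}`, the cardinality of the support of `f_λ`. -/
def nSupp {m s : ℕ} (F : GF m → GF s) (lam : GF s) : ℕ := Fintype.card (Dsupp F lam)

/-- The codeword `c_{x,y} = (Tr(x·d) + Tr(y·F(d)))_{d ∈ D_{f_λ}}`. -/
def cw {m s : ℕ} (F : GF m → GF s) (lam : GF s) (x : GF m) (y : GF s) :
    Dsupp F lam → ZMod 2 :=
  fun d => tr (x * d.1) + tr (y * F d.1)

/-- Hamming weight of the codeword `c_{x,y}`. -/
def wtc {m s : ℕ} (F : GF m → GF s) (lam : GF s) (x : GF m) (y : GF s) : ℕ :=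
  (univ.filter (fun d : Dsupp F lam => cw F lam x y d ≠ 0)).card

theorem tr_add {n : ℕ} (x y : GF n) : tr (x + y) = tr x + tr y := map_add _ x y

theorem tr_zero {n : ℕ} : tr (0 : GF n) = 0 := map_zero _

theorem exists_tr_mul_eq_one {n : ℕ} {a : GF n} (ha : a ≠ 0) : ∃ x : GF n, tr (a * x) = 1 := by
  obtain ⟨y, hy⟩ := Algebra.trace_surjective (ZMod 2) (GF n) 1
  exact ⟨a⁻¹ * y, by rw [mul_inv_cancel_left₀ ha]; exact hy⟩

theorem sum_neg_one_pow_tr_mul_eq_zero {n : ℕ} {a : GF n} (ha : a ≠ 0) :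
    ∑ x : GF n, (-1 : ℤ) ^ (tr (a * x)).val = 0 := by
  obtain ⟨x₀, hx₀⟩ := exists_tr_mul_eq_one ha
  have flip : ∀ t : ZMod 2, (-1 : ℤ) ^ (t + 1).val = -(-1) ^ t.val := by decide
  have h := Equiv.sum_comp (Equiv.addRight x₀) fun x : GF n => (-1 : ℤ) ^ (tr (a * x)).val
  simp only [Equiv.coe_addRight, mul_add, tr_add, hx₀, flip, Finset.sum_neg_distrib] at h
  linarith

theorem wtc_eq_sum {m s : ℕ} (F : GF m → GF s) (lam : GF s) (x : GF m) (y : GF s) :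
    (wtc F lam x y : ℤ) =
      ∑ d : GF m, if tr (lam * F d) = 1 ∧ tr (x * d) + tr (y * F d) ≠ 0 then 1 else 0 := by
  rw [Finset.sum_boole, wtc, ← Finset.card_map (Function.Embedding.subtype _)]
  congr 2
  ext d
  simp only [Finset.mem_map, Finset.mem_filter, Finset.mem_univ, true_and]
  exact ⟨fun ⟨e, he, h⟩ => h ▸ ⟨e.2, he⟩, fun ⟨h₁, h₂⟩ => ⟨⟨d, h₁⟩, h₂, rfl⟩⟩

theorem nSupp_eq_sum {m s : ℕ} (F : GF m → GF s) (lam : GF s) :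
    (nSupp F lam : ℤ) = ∑ d : GF m, if tr (lam * F d) = 1 then 1 else 0 := by
  rw [Finset.sum_boole, nSupp, Fintype.card_subtype]

theorem four_mul_wtc_zero_right {m s : ℕ} (F : GF m → GF s) (lam : GF s) {a : GF m} (ha : a ≠ 0) :
    4 * (wtc F lam a 0 : ℤ) = 2 * nSupp F lam + walshF F lam a := by
  have key : ∀ f t : ZMod 2, 4 * (if f = 1 ∧ t ≠ 0 then 1 else 0 : ℤ) =
      2 * (if f = 1 then 1 else 0) + (-1) ^ (f + t).val - (-1) ^ t.val := by decide
  rw [← sub_zero (_ + _), ← sum_neg_one_pow_tr_mul_eq_zero ha, wtc_eq_sum, nSupp_eq_sum, walshF,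
    Finset.mul_sum, Finset.mul_sum, ← Finset.sum_add_distrib, ← Finset.sum_sub_distrib]
  refine Finset.sum_congr rfl fun d _ => ?_
  rw [← key, zero_mul, tr_zero, add_zero]

theorem four_mul_wtc_self_right {m s : ℕ} (F : GF m → GF s) (lam : GF s) {a : GF m} (ha : a ≠ 0) :
    4 * (wtc F lam a lam : ℤ) = 2 * nSupp F lam - walshF F lam a := by
  have key : ∀ f t : ZMod 2, 4 * (if f = 1 ∧ t + f ≠ 0 then 1 else 0 : ℤ) =
      2 * (if f = 1 then 1 else 0) - (-1) ^ (f + t).val + (-1) ^ t.val := by decide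
  rw [← add_zero (_ - _), ← sum_neg_one_pow_tr_mul_eq_zero ha, wtc_eq_sum, nSupp_eq_sum, walshF,
    Finset.mul_sum, Finset.mul_sum, ← Finset.sum_sub_distrib, ← Finset.sum_add_distrib]
  refine Finset.sum_congr rfl fun d _ => ?_
  rw [← key]

theorem wtc_zero_left_self {m s : ℕ} (F : GF m → GF s) (lam : GF s) :
    wtc F lam 0 lam = nSupp F lam := by
  rw [wtc, nSupp, ← Finset.card_univ, Finset.filter_true_of_mem]
  rintro ⟨d, hd⟩ -
  simp [cw, hd, tr_zero]

/-- weights of the codewords `c_{a,0}`, `c_{a,λ}` (for `a ≠ 0`) and `c_{0,λ}`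
of the code `C_{D_{f_λ}}`. -/
theorem stmt17 (m s : ℕ) (hm : 1 ≤ m) (hs : 1 ≤ s)
    (F : GF m → GF s) (lam : GF s) (hlam : lam ≠ 0) :
    (∀ a : GF m, a ≠ 0 →
      (wtc F lam a 0 : ℚ) = (2 * (nSupp F lam : ℚ) + (walshF F lam a : ℚ)) / 4 ∧
      (wtc F lam a lam : ℚ) = (2 * (nSupp F lam : ℚ) - (walshF F lam a : ℚ)) / 4) ∧
    wtc F lam 0 lam = nSupp F lam := by
  refine ⟨fun a ha => ⟨?_, ?_⟩, wtc_zero_left_self F lam⟩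
  · rw [eq_div_iff (by norm_num), mul_comm]
    exact_mod_cast four_mul_wtc_zero_right F lam ha
  · rw [eq_div_iff (by norm_num), mul_comm]
    exact_mod_cast four_mul_wtc_self_right F lam ha
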